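/- For natural numbers n, m, s with m ≤ n and s ≥ 2, and for every real polynomial A with deg(A) < m, one has Σ_{i=0}^n C(n,i) (s−1)^i K_{m,n,s}(i) A(i) = 0. -/

import Mathlib

open Polynomial Finset

/-- `P j` is the polynomial `X(X-1)⋯(X-j+1)/j!` (with `P 0 = 1`). -/
noncomputable def P (j : ℕ) : Polynomial ℝ :=
  Polynomial.C (1 / (j.factorial : ℝ)) *
    ∏ i ∈ Finset.range j, (Polynomial.X - Polynomial.C (i : ℝ))

/-- The Krawtchouk polynomial `K_{m,n,s}(X) = Σ_{j=0}^m (-1)^j P_j(X) P_{m-j}(n-X) (s-1)^{m-j}`. -/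
noncomputable def K (m n s : ℕ) : Polynomial ℝ :=
  ∑ j ∈ Finset.range (m + 1),
    Polynomial.C ((-1 : ℝ) ^ j * ((s : ℝ) - 1) ^ (m - j)) *
      (P j * (P (m - j)).comp (Polynomial.C (n : ℝ) - Polynomial.X))

theorem P_eval_natCast (j i : ℕ) : (P j).eval (i : ℝ) = (i.choose j : ℝ) := by
  have h := descPochhammer_eval_eq_descFactorial ℝ i j
  rw [descPochhammer_eval_eq_prod_range] at h
  simp only [P, eval_mul, eval_C, eval_prod, eval_sub, eval_X]
  rw [h, Nat.descFactorial_eq_factorial_mul_choose]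
  push_cast
  field_simp

theorem coeff_one_add_C_mul_X_pow (a : ℝ) (k j : ℕ) :
    ((1 + C a * X : ℝ[X]) ^ k).coeff j = (k.choose j : ℝ) * a ^ j := by
  have h : (1 + C a * X : ℝ[X]) ^ k = ((1 + X : ℝ[X]) ^ k).comp (C a * X) := by simp
  rw [h, comp_C_mul_X_coeff, coeff_one_add_X_pow]

/-- The generating function of the Krawtchouk polynomials at an integer point. -/
theorem K_eval_eq_coeff (m n s i : ℕ) (hi : i ≤ n) :
    (K m n s).eval (i : ℝ) =
      ((1 + C (-1) * X : ℝ[X]) ^ i * (1 + C ((s : ℝ) - 1) * X) ^ (n - i)).coeff m := by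
  rw [coeff_mul, Finset.Nat.sum_antidiagonal_eq_sum_range_succ_mk, K, eval_finsetSum]
  refine Finset.sum_congr rfl fun j _ => ?_
  have h : (n : ℝ) - i = ((n - i : ℕ) : ℝ) := (Nat.cast_sub hi).symm
  simp only [eval_mul, eval_C, eval_comp, eval_sub, eval_X, h, P_eval_natCast,
    coeff_one_add_C_mul_X_pow]
  ring

/-- If `u + v` is constant and `u` has degree at most one, then weighting the binomial expansion of
`(u + v) ^ n` by the values of a polynomial of degree at most `d` gives degree at most `d`. -/
theorem natDegree_sum_choose_mul_eval_le {u v : ℝ[X]} (hu : u.natDegree ≤ 1) {c : ℝ}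
    (huv : u + v = C c) (d n : ℕ) (A : ℝ[X]) (hA : A.natDegree ≤ d) :
    (∑ i ∈ range (n + 1),
      C ((n.choose i : ℝ) * A.eval (i : ℝ)) * (u ^ i * v ^ (n - i))).natDegree ≤ d := by
  have const (a : ℝ) (n : ℕ) :
      (∑ i ∈ range (n + 1), C ((n.choose i : ℝ) * a) * (u ^ i * v ^ (n - i))) =
        C (a * c ^ n) := by
    rw [C_mul, C_pow, ← huv, add_pow, Finset.mul_sum]
    refine Finset.sum_congr rfl fun i _ => ?_
    simp only [C_mul, map_natCast]
    ring
  induction d generalizing n A with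
  | zero =>
    obtain ⟨a, rfl⟩ := natDegree_eq_zero.mp (Nat.le_zero.mp hA)
    simp only [eval_C, const, natDegree_C, le_refl]
  | succ d ih =>
    cases n with
    | zero => simp
    | succ n =>
      have hB : (A.divX.comp (X + C 1)).natDegree ≤ d := by
        rw [natDegree_comp, natDegree_X_add_C, mul_one, natDegree_divX_eq_natDegree_tsub_one]
        omega
      have hsplit : (∑ i ∈ range (n + 1 + 1),
          C (((n + 1).choose i : ℝ) * A.eval (i : ℝ)) * (u ^ i * v ^ (n + 1 - i))) =
          C ((n + 1 : ℝ)) * (u * ∑ i ∈ range (n + 1),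
            C ((n.choose i : ℝ) * (A.divX.comp (X + C 1)).eval (i : ℝ)) *
              (u ^ i * v ^ (n - i))) + C (A.coeff 0 * c ^ (n + 1)) := by
        rw [← const (A.coeff 0) (n + 1)]
        have hev (x : ℝ) : A.eval x = A.divX.eval x * x + A.coeff 0 := by
          conv_lhs => rw [← divX_mul_X_add A]
          simp
        rw [← sub_eq_iff_eq_add, ← Finset.sum_sub_distrib]
        simp only [← sub_mul, ← C_sub, ← mul_sub, hev, add_sub_cancel_right]
        rw [Finset.sum_range_succ', Finset.mul_sum, Finset.mul_sum]
        simp only [Nat.cast_zero, mul_zero, C_0, zero_mul, add_zero]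
        refine Finset.sum_congr rfl fun i _ => ?_
        have hc : ((n + 1).choose (i + 1) : ℝ) * ((i : ℝ) + 1) = (n + 1) * n.choose i := by
          exact_mod_cast (Nat.add_one_mul_choose_eq n i).symm
        rw [Nat.add_sub_add_right, eval_comp, eval_add, eval_X, eval_C, Nat.cast_add_one,
          show ((n + 1).choose (i + 1) : ℝ) * (A.divX.eval ((i : ℝ) + 1) * ((i : ℝ) + 1)) =
            (n + 1) * (n.choose i * A.divX.eval ((i : ℝ) + 1)) by
              linear_combination A.divX.eval ((i : ℝ) + 1) * hc, C_mul]
        ring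
      rw [hsplit, natDegree_add_C]
      refine (natDegree_C_mul_le _ _).trans (natDegree_mul_le.trans ?_)
      have := ih n _ hB
      omega

theorem krawtchouk_orthogonal_lowDegree (n m s : ℕ) (hm : m ≤ n) (hs : 2 ≤ s)
    (A : Polynomial ℝ) (hA : A.degree < m) :
    ∑ i ∈ Finset.range (n + 1),
      (n.choose i : ℝ) * ((s : ℝ) - 1) ^ i *
        ((K m n s).eval (i : ℝ) * A.eval (i : ℝ)) = 0 := by
  rcases m with _ | d
  · have hA0 : A = 0 := by simpa using hA
    simp [hA0]
  set q : ℝ := (s : ℝ) - 1 with hq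
  have hdeg : A.natDegree ≤ d :=
    natDegree_le_iff_coeff_eq_zero.mpr fun k hk =>
      (degree_lt_iff_coeff_zero A (d + 1)).mp hA k hk
  have hu : (C q * (1 + C (-1) * X) : ℝ[X]).natDegree ≤ 1 := by compute_degree
  have huv : (C q * (1 + C (-1) * X) : ℝ[X]) + (1 + C q * X) = C (q + 1) := by
    simp only [C_neg, C_1, C_add]
    ring
  have hle := natDegree_sum_choose_mul_eval_le hu huv d n A hdeg
  have hcoeff := coeff_eq_zero_of_natDegree_lt (Nat.lt_succ_of_le hle)
  rw [finsetSum_coeff] at hcoeff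
  rw [← hcoeff]
  refine Finset.sum_congr rfl fun i hi => ?_
  rw [K_eval_eq_coeff _ _ _ _ (Nat.lt_succ_iff.mp (Finset.mem_range.mp hi)), mul_pow,
    mul_assoc (C q ^ i), ← C_pow, coeff_C_mul, coeff_C_mul]
  ring
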